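/- Lerch's formula: for every real x > 0, the derivative at s = 0 of the Hurwitz zeta function satisfies ζ'(0,x) = log(Γ(x)/√(2π)). -/

import Mathlib

/-- `H` is the meromorphic continuation of the Hurwitz zeta function
`ζ(s,x) = ∑_{n≥0} (x+n)^{-s}`. -/
def IsHurwitzZeta (x : ℝ) (H : ℂ → ℂ) : Prop :=
  DifferentiableOn ℂ H ({1} : Set ℂ)ᶜ ∧
    ∀ s : ℂ, 1 < s.re → H s = ∑' n : ℕ, ((x : ℂ) + n) ^ (-s)

open Filter Topology

noncomputable def lerchG (a : ℝ) (s : ℂ) : ℂ :=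
  ((a : ℂ) ^ (-s) + ((a : ℂ) + 1) ^ (-s)) / 2 +
    (((a : ℂ) + 1) ^ (1 - s) - (a : ℂ) ^ (1 - s)) / (s - 1)

lemma lerch_hasDerivAt_cpow (a : ℝ) (ha : 0 < a) (t : ℝ) (ht : 0 ≤ t) (c : ℂ) :
    HasDerivAt (fun u : ℝ => ((a : ℂ) + u) ^ c) (c * ((a : ℂ) + t) ^ (c - 1)) t := by
  have h1 : HasDerivAt (fun u : ℂ => (a : ℂ) + u) 1 (t : ℂ) := (hasDerivAt_id _).const_add _
  have hm : (a : ℂ) + t ∈ Complex.slitPlane := by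
    left; simp; linarith
  have h2 := (h1.cpow_const (c := c) hm).comp_ofReal
  simpa using h2

lemma lerchG_bound (a : ℝ) (ha : 0 < a) (s : ℂ) (hs : s ≠ 1) (hre : -2 ≤ s.re) :
    ‖lerchG a s‖ ≤ ‖s‖ * ‖s + 1‖ * a ^ (-s.re - 2) := by
  have hs1 : (1 : ℂ) - s ≠ 0 := sub_ne_zero.2 hs.symm
  have hs2 : s - 1 ≠ 0 := sub_ne_zero.2 hs
  let Ψ : ℝ → ℂ := fun t => ((t : ℂ) * (1 - t) / 2) * (-s * ((a : ℂ) + t) ^ (-s - 1))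
    - ((1 - 2 * (t : ℂ)) / 2) * ((a : ℂ) + t) ^ (-s) - ((a : ℂ) + t) ^ (1 - s) / (1 - s)
  let Ψ' : ℝ → ℂ := fun t => ((t : ℂ) * (1 - t) / 2) * (s * (s + 1) * ((a : ℂ) + t) ^ (-s - 2))
  have key : ‖Ψ 1 - Ψ 0‖ ≤ ‖s‖ * ‖s + 1‖ * a ^ (-s.re - 2) := by
    refine norm_image_sub_le_of_norm_deriv_le_segment_01' (f' := Ψ') ?_ ?_
    · intro t ht
      refine HasDerivAt.hasDerivWithinAt ?_
      have e1 := lerch_hasDerivAt_cpow a ha t ht.1 (-s - 1)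
      have e2 := lerch_hasDerivAt_cpow a ha t ht.1 (-s)
      have e3 := lerch_hasDerivAt_cpow a ha t ht.1 (1 - s)
      have ei : HasDerivAt (fun u : ℝ => (u : ℂ)) 1 t := Complex.ofRealCLM.hasDerivAt
      have p1 : HasDerivAt (fun u : ℝ => (u : ℂ) * (1 - u) / 2) ((1 - 2 * (t : ℂ)) / 2) t := by
        convert! (ei.mul (ei.const_sub 1)).div_const 2 using 1
        ring
      have p2 : HasDerivAt (fun u : ℝ => (1 - 2 * (u : ℂ)) / 2) (-1) t := by
        convert! ((ei.const_mul 2).const_sub 1).div_const 2 using 1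
        ring
      have := ((p1.mul (e1.const_mul (-s))).sub (p2.mul e2)).sub (e3.div_const (1 - s))
      convert! this using 1
      have q1 : (-s - 1 - 1 : ℂ) = -s - 2 := by ring
      have q2 : (1 - s - 1 : ℂ) = -s := by ring
      simp only [Ψ', q1, q2]
      field_simp
      ring
    · intro t ht
      have hat : 0 < a + t := by linarith [ht.1]
      have n1 : ‖((a : ℂ) + t) ^ (-s - 2)‖ = (a + t) ^ (-s.re - 2) := by
        rw [← Complex.ofReal_add, Complex.norm_cpow_eq_rpow_re_of_pos hat]
        simp
      have n2 : (a + t) ^ (-s.re - 2) ≤ a ^ (-s.re - 2) :=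
        Real.rpow_le_rpow_of_nonpos ha (by linarith [ht.1]) (by linarith)
      have n3 : ‖(t : ℂ) * (1 - t) / 2‖ ≤ 1 := by
        have : (t : ℂ) * (1 - t) / 2 = ((t * (1 - t) / 2 : ℝ) : ℂ) := by push_cast; ring
        rw [this, Complex.norm_real, Real.norm_eq_abs, abs_le]
        constructor <;> nlinarith [ht.1, ht.2]
      simp only [Ψ']
      rw [norm_mul, norm_mul, norm_mul, n1]
      calc _ ≤ 1 * (‖s‖ * ‖s + 1‖ * a ^ (-s.re - 2)) := by gcongr
        _ = _ := one_mul _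
  convert! key using 2
  simp only [Ψ, lerchG]
  have : s - 1 = -(1 - s) := by ring
  rw [this, div_neg]
  push_cast
  simp only [add_zero]
  ring

lemma lerch_summable (x : ℝ) (hx : 0 < x) (c : ℝ) (hc : 1 < c) :
    Summable (fun n : ℕ => (x + n) ^ (-c)) := by
  refine ((Real.summable_one_div_nat_add_rpow x c).2 hc).congr fun n => ?_
  have : 0 < x + n := by positivity
  rw [add_comm (n : ℝ) x, abs_of_pos this, Real.rpow_neg this.le, one_div]

lemma lerchG_bound' (x : ℝ) (hx : 0 < x) (n : ℕ) (s : ℂ) (hs : s ≠ 1)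
    (hre : -(1 / 2) ≤ s.re) (hre' : s.re ≤ 5 / 2) (hn : ‖s‖ ≤ 3) :
    ‖lerchG (x + n) s‖ ≤ 12 * (1 + x ^ (-3 : ℝ)) * (x + n) ^ (-(3 / 2) : ℝ) := by
  have hxn : 0 < x + n := by positivity
  refine (lerchG_bound _ hxn s hs (by linarith)).trans ?_
  have h1 : ‖s + 1‖ ≤ 4 := (norm_add_le _ _).trans (by norm_num; linarith)
  have h2 : (x + n) ^ (-s.re - 2) = (x + n) ^ (-s.re - 1 / 2) * (x + n) ^ (-(3 / 2) : ℝ) := by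
    rw [← Real.rpow_add hxn]; congr 1; ring
  have h3 : (x + n) ^ (-s.re - 1 / 2) ≤ x ^ (-s.re - 1 / 2) :=
    Real.rpow_le_rpow_of_nonpos hx (by simp) (by linarith)
  have h4 : x ^ (-s.re - 1 / 2) ≤ 1 + x ^ (-3 : ℝ) := by
    have p3 : 0 < x ^ (-3 : ℝ) := Real.rpow_pos_of_pos hx _
    rcases le_total 1 x with h | h
    · have := Real.rpow_le_one_of_one_le_of_nonpos h (show -s.re - 1 / 2 ≤ 0 by linarith)
      linarith
    · have := Real.rpow_le_rpow_of_exponent_ge hx h (show (-3 : ℝ) ≤ -s.re - 1 / 2 by linarith)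
      linarith
  rw [h2, ← mul_assoc]
  have h5 := h3.trans h4
  calc _ ≤ 3 * 4 * (1 + x ^ (-3 : ℝ)) * (x + n) ^ (-(3 / 2) : ℝ) := by gcongr
    _ = _ := by ring

lemma lerch_cpow_deriv (a : ℂ) (ha : a ≠ 0) (c s : ℂ) :
    HasDerivAt (fun s : ℂ => a ^ (c - s)) (-(a ^ (c - s) * Complex.log a)) s := by
  have := ((hasDerivAt_id s).const_sub c).const_cpow (c := a) (Or.inl ha)
  simpa using this

lemma lerchG_diff (a : ℝ) (ha : 0 < a) (s : ℂ) (hs : s ≠ 1) :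
    DifferentiableAt ℂ (lerchG a) s := by
  have a0 : (a : ℂ) ≠ 0 := by exact_mod_cast ha.ne'
  have a1 : (a : ℂ) + 1 ≠ 0 := by exact_mod_cast (by positivity : a + 1 ≠ 0)
  have hs2 : s - 1 ≠ 0 := sub_ne_zero.2 hs
  have d : ∀ b : ℂ, b ≠ 0 → DifferentiableAt ℂ (fun s : ℂ => b ^ (-s)) s := fun b hb => by
    simpa using (lerch_cpow_deriv b hb 0 s).differentiableAt
  exact (((d _ a0).add (d _ a1)).div_const 2).add
    (((lerch_cpow_deriv _ a1 1 s).differentiableAt.sub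
      (lerch_cpow_deriv _ a0 1 s).differentiableAt).div (by fun_prop) hs2)

lemma lerch_P_diff (x : ℝ) (hx : 0 < x) (s : ℂ) (hs : s ≠ 1) :
    DifferentiableAt ℂ (fun s : ℂ => (x : ℂ) ^ (-s) / 2 + (x : ℂ) ^ (1 - s) / (s - 1)) s := by
  have x0 : (x : ℂ) ≠ 0 := by exact_mod_cast hx.ne'
  have hs2 : s - 1 ≠ 0 := sub_ne_zero.2 hs
  have d1 : DifferentiableAt ℂ (fun s : ℂ => (x : ℂ) ^ (-s)) s := by
    simpa using (lerch_cpow_deriv x x0 0 s).differentiableAt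
  have d2 : DifferentiableAt ℂ (fun s : ℂ => s - 1) s := by fun_prop
  have d3 := (lerch_cpow_deriv x x0 1 s).differentiableAt
  exact (d1.div_const 2).add (d3.div d2 hs2)

/-- derivative at zero of the elementary pieces -/
lemma lerch_half (a : ℝ) (ha : 0 < a) :
    HasDerivAt (fun s : ℂ => (a : ℂ) ^ (-s)) (((- Real.log a : ℝ)) : ℂ) 0 := by
  have a0 : (a : ℂ) ≠ 0 := by exact_mod_cast ha.ne'
  have := lerch_cpow_deriv a a0 0 0
  simp only [zero_sub, neg_zero, Complex.cpow_zero, one_mul] at this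
  rw [Complex.ofReal_neg, Complex.ofReal_log ha.le]
  exact this

lemma lerch_pole (a : ℝ) (ha : 0 < a) :
    HasDerivAt (fun s : ℂ => (a : ℂ) ^ (1 - s) / (s - 1)) (((a * Real.log a - a : ℝ)) : ℂ) 0 := by
  have a0 : (a : ℂ) ≠ 0 := by exact_mod_cast ha.ne'
  have := (lerch_cpow_deriv a a0 1 0).div ((hasDerivAt_id (0 : ℂ)).sub_const 1) (by simp)
  convert! this using 1
  rw [Complex.ofReal_sub, Complex.ofReal_mul, Complex.ofReal_log ha.le]
  simp

lemma lerchG_deriv (a : ℝ) (ha : 0 < a) :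
    deriv (lerchG a) 0 = ((-(Real.log a + Real.log (a + 1)) / 2 +
      ((a + 1) * Real.log (a + 1) - a * Real.log a) - 1 : ℝ) : ℂ) := by
  have ha1 : 0 < a + 1 := by linarith
  have := (((lerch_half a ha).add (lerch_half _ ha1)).div_const 2).add
    ((lerch_pole _ ha1).sub (lerch_pole a ha))
  have e : lerchG a = fun s : ℂ => ((a : ℂ) ^ (-s) + ((a + 1 : ℝ) : ℂ) ^ (-s)) / 2 +
    (((a + 1 : ℝ) : ℂ) ^ (1 - s) / (s - 1) - (a : ℂ) ^ (1 - s) / (s - 1)) := by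
    ext s; simp only [lerchG]; push_cast; ring
  rw [e]
  refine (HasDerivAt.deriv this).trans ?_
  push_cast
  ring

lemma lerch_partial (x : ℝ) (s : ℂ) (N : ℕ) :
    ∑ n ∈ Finset.range N, lerchG (x + n) s =
      ∑ n ∈ Finset.range N, ((x : ℂ) + n) ^ (-s) - (x : ℂ) ^ (-s) / 2
        + ((x : ℂ) + N) ^ (-s) / 2 + ((x : ℂ) + N) ^ (1 - s) / (s - 1)
        - (x : ℂ) ^ (1 - s) / (s - 1) := by
  induction N with
  | zero => simp
  | succ N ih =>
    rw [Finset.sum_range_succ, Finset.sum_range_succ, ih, lerchG]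
    push_cast
    rw [← add_assoc]
    ring

lemma lerch_tendsto_zero (x : ℝ) (hx : 0 < x) (c : ℂ) (hc : c.re < 0) :
    Tendsto (fun N : ℕ => ((x : ℂ) + N) ^ c) atTop (𝓝 0) := by
  rw [tendsto_zero_iff_norm_tendsto_zero]
  have h : Tendsto (fun N : ℕ => x + (N : ℝ)) atTop atTop :=
    tendsto_atTop_add_const_left _ _ tendsto_natCast_atTop_atTop
  have h2 := (tendsto_rpow_neg_atTop (y := -c.re) (by linarith)).comp h
  refine h2.congr fun N => ?_
  have : 0 < x + N := by positivity
  simp only [Function.comp]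
  rw [← Complex.ofReal_natCast, ← Complex.ofReal_add, Complex.norm_cpow_eq_rpow_re_of_pos this,
    neg_neg]

lemma lerch_sum (x : ℝ) (hx : 0 < x) (s : ℂ) (hs : 1 < s.re) (h52 : s.re ≤ 5 / 2)
    (hn : ‖s‖ ≤ 3) :
    ∑' n : ℕ, ((x : ℂ) + n) ^ (-s) =
      (x : ℂ) ^ (-s) / 2 + (x : ℂ) ^ (1 - s) / (s - 1) + ∑' n : ℕ, lerchG (x + n) s := by
  have hs1 : s ≠ 1 := by rintro rfl; simp at hs
  have hsum1 : Summable (fun n : ℕ => ((x : ℂ) + n) ^ (-s)) := by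
    refine Summable.of_norm_bounded (lerch_summable x hx s.re hs) fun n => ?_
    have : 0 < x + n := by positivity
    rw [← Complex.ofReal_natCast, ← Complex.ofReal_add, Complex.norm_cpow_eq_rpow_re_of_pos this]
    simp
  have hsum2 : Summable (fun n : ℕ => lerchG (x + n) s) :=
    Summable.of_norm_bounded ((lerch_summable x hx (3 / 2) (by norm_num)).mul_left _)
      fun n => lerchG_bound' x hx n s hs1 (by linarith) h52 hn
  have t1 := hsum2.hasSum.tendsto_sum_nat
  simp_rw [lerch_partial] at t1
  have t2 := (((hsum1.hasSum.tendsto_sum_nat.sub_const ((x : ℂ) ^ (-s) / 2)).add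
    ((lerch_tendsto_zero x hx (-s) (by simp; linarith)).div_const 2)).add
    ((lerch_tendsto_zero x hx (1 - s) (by simp; linarith)).div_const (s - 1))).sub_const
      ((x : ℂ) ^ (1 - s) / (s - 1))
  have := tendsto_nhds_unique t1 t2
  rw [this]; ring

lemma lerch_limit (x : ℝ) (hx : 0 < x) :
    Tendsto (fun N : ℕ => -∑ n ∈ Finset.range (N + 1), Real.log (x + n)
      + (x + (N + 1 : ℕ) - 1 / 2) * Real.log (x + (N + 1 : ℕ)) - (x + (N + 1 : ℕ))) atTop
      (𝓝 (Real.log (Real.Gamma x / Real.sqrt (2 * Real.pi)))) := by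
  have g1 : Tendsto (fun N => Real.log (Real.GammaSeq x N)) atTop (𝓝 (Real.log (Real.Gamma x))) :=
    (Real.continuousAt_log (Real.Gamma_pos_of_pos hx).ne').tendsto.comp
      (Real.GammaSeq_tendsto_Gamma x)
  have hpi : Real.sqrt Real.pi ≠ 0 := (Real.sqrt_pos.2 Real.pi_pos).ne'
  have g2 : Tendsto (fun N => Real.log (Stirling.stirlingSeq N)) atTop
      (𝓝 (Real.log (Real.sqrt Real.pi))) :=
    (Real.continuousAt_log hpi).tendsto.comp Stirling.tendsto_stirlingSeq_sqrt_pi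
  have g3 : Tendsto (fun N : ℕ => (N : ℝ) * Real.log (1 + (x + 1) / N)) atTop (𝓝 (x + 1)) :=
    (Real.tendsto_mul_log_one_add_div_atTop (x + 1)).comp tendsto_natCast_atTop_atTop
  have g4 : Tendsto (fun N : ℕ => Real.log (1 + (x + 1) / N)) atTop (𝓝 0) := by
    have : Tendsto (fun N : ℕ => 1 + (x + 1) / (N : ℝ)) atTop (𝓝 (1 + 0)) :=
      (tendsto_const_div_atTop_nhds_zero_nat (x + 1)).const_add 1
    rw [add_zero] at this
    have := (Real.continuousAt_log one_ne_zero).tendsto.comp this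
    rwa [Real.log_one] at this
  have g := (((g1.sub g2).sub_const (Real.log 2 / 2)).add
    (g3.add (g4.const_mul (x + 1 / 2)))).sub_const (x + 1)
  have e : Real.log (Real.Gamma x) - Real.log (Real.sqrt Real.pi) - Real.log 2 / 2
      + (x + 1 + (x + 1 / 2) * 0) - (x + 1)
      = Real.log (Real.Gamma x / Real.sqrt (2 * Real.pi)) := by
    have := Real.pi_pos
    rw [Real.log_div (Real.Gamma_pos_of_pos hx).ne' (by positivity), Real.log_sqrt (by positivity),
      Real.log_sqrt (by positivity), Real.log_mul (by norm_num) (by positivity)]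
    ring
  rw [e] at g
  refine g.congr' ?_
  filter_upwards [eventually_gt_atTop 0] with N hN
  have hN' : (0 : ℝ) < N := by exact_mod_cast hN
  have hprod : ∀ j ∈ Finset.range (N + 1), x + (j : ℝ) ≠ 0 := fun j _ => by positivity
  have l1 : Real.log (Real.GammaSeq x N) = x * Real.log N + Real.log (N.factorial)
      - ∑ n ∈ Finset.range (N + 1), Real.log (x + n) := by
    rw [Real.GammaSeq, Real.log_div (by positivity) (Finset.prod_ne_zero_iff.2 hprod),
      Real.log_mul (by positivity) (by positivity), Real.log_rpow hN', Real.log_prod hprod]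
  have l2 : Real.log (1 + (x + 1) / N) = Real.log (x + (N + 1 : ℕ)) - Real.log N := by
    rw [← Real.log_div (by positivity) hN'.ne']
    congr 1
    push_cast
    field_simp
    ring
  rw [l1, l2, Stirling.log_stirlingSeq_formula, Real.log_mul (by norm_num) hN'.ne',
    Real.log_div hN'.ne' (Real.exp_pos 1).ne', Real.log_exp]
  push_cast
  ring

lemma lerch_partial' (x : ℝ) (N : ℕ) :
    ∑ n ∈ Finset.range N, (-(Real.log (x + n) + Real.log (x + n + 1)) / 2 +
      ((x + n + 1) * Real.log (x + n + 1) - (x + n) * Real.log (x + n)) - 1) =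
      -∑ n ∈ Finset.range N, Real.log (x + n)
      + (x + N - 1 / 2) * Real.log (x + N) - (x + N)
      - (-Real.log x / 2 + (x * Real.log x - x)) := by
  induction N with
  | zero => simp; ring
  | succ N ih =>
    rw [Finset.sum_range_succ, Finset.sum_range_succ, ih]
    push_cast
    rw [← add_assoc]
    ring

theorem lerch_formula (x : ℝ) (hx : 0 < x) (H : ℂ → ℂ) (hH : IsHurwitzZeta x H) :
    deriv H 0 = (Real.log (Real.Gamma x / Real.sqrt (2 * Real.pi)) : ℂ) := by
  obtain ⟨hd, hser⟩ := hH
  let A : Set ℂ := {s | 0 < s.im} ∩ Metric.ball 1 (3 / 2)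
  let B : Set ℂ := {s | s.re < 1} ∩ Metric.ball 1 (3 / 2)
  let U : Set ℂ := A ∪ B
  have hAo : IsOpen A := (isOpen_lt continuous_const Complex.continuous_im).inter Metric.isOpen_ball
  have hBo : IsOpen B := (isOpen_lt Complex.continuous_re continuous_const).inter Metric.isOpen_ball
  have hUo : IsOpen U := hAo.union hBo
  have hAc : IsPreconnected A :=
    ((convex_halfSpace_im_gt 0).inter (convex_ball _ _)).isPreconnected
  have hBc : IsPreconnected B :=
    ((convex_halfSpace_re_lt 1).inter (convex_ball _ _)).isPreconnected
  have hball : ∀ s : ℂ, s ∈ Metric.ball (1 : ℂ) (3 / 2) →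
      -(1 / 2) ≤ s.re ∧ s.re ≤ 5 / 2 ∧ ‖s‖ ≤ 3 := by
    intro s hs
    rw [mem_ball_iff_norm] at hs
    have h1 := (abs_le.1 ((Complex.abs_re_le_norm (s - 1)).trans hs.le))
    simp only [Complex.sub_re, Complex.one_re] at h1
    refine ⟨by linarith [h1.1], by linarith [h1.2], ?_⟩
    have := norm_add_le (s - 1) 1
    simp only [sub_add_cancel, norm_one] at this
    linarith
  have hUball : ∀ s ∈ U, s ∈ Metric.ball (1 : ℂ) (3 / 2) := by
    rintro s (h | h) <;> exact h.2
  have hU1 : ∀ s ∈ U, s ≠ 1 := by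
    rintro s (h | h) rfl
    · simpa using h.1
    · simpa using h.1
  have hUc : IsPreconnected U := by
    refine IsPreconnected.union (1 / 2 + Complex.I / 2) ?_ ?_ hAc hBc
    all_goals
      refine ⟨by simp; try norm_num, ?_⟩
      rw [mem_ball_iff_norm]
      have : (1 / 2 + Complex.I / 2 - 1 : ℂ) = -(1 / 2) + Complex.I / 2 := by ring
      rw [this]
      refine (norm_add_le _ _).trans_lt ?_
      simp
      norm_num
  have h0U : (0 : ℂ) ∈ U := Or.inr ⟨by simp, by rw [mem_ball_iff_norm]; simp; norm_num⟩
  have hdiffG : ∀ n : ℕ, DifferentiableOn ℂ (lerchG (x + n)) U := fun n s hs =>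
    (lerchG_diff (x + n) (by positivity) s (hU1 s hs)).differentiableWithinAt
  have hbd : ∀ (n : ℕ) (s : ℂ), s ∈ U →
      ‖lerchG (x + n) s‖ ≤ 12 * (1 + x ^ (-3 : ℝ)) * (x + n) ^ (-(3 / 2) : ℝ) := by
    intro n s hs
    obtain ⟨b1, b2, b3⟩ := hball s (hUball s hs)
    exact lerchG_bound' x hx n s (hU1 s hs) b1 b2 b3
  have hu := (lerch_summable x hx (3 / 2) (by norm_num)).mul_left (12 * (1 + x ^ (-3 : ℝ)))
  have hdT := Complex.differentiableOn_tsum_of_summable_norm hu hdiffG hUo hbd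
  have hderT := Complex.hasSum_deriv_of_summable_norm hu hdiffG hUo hbd h0U
  let P : ℂ → ℂ := fun s => (x : ℂ) ^ (-s) / 2 + (x : ℂ) ^ (1 - s) / (s - 1)
  let T : ℂ → ℂ := fun s => ∑' n : ℕ, lerchG (x + n) s
  have hdP : DifferentiableOn ℂ P U := fun s hs => by
    exact (lerch_P_diff x hx s (hU1 s hs)).differentiableWithinAt
  have hdH : DifferentiableOn ℂ H U := hd.mono fun s hs => hU1 s hs
  let z : ℂ := 3 / 2 + Complex.I / 2
  have hzU : z ∈ U := by
    refine Or.inl ⟨by simp [z], ?_⟩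
    rw [mem_ball_iff_norm]
    have : (z - 1 : ℂ) = (1 / 2) + Complex.I / 2 := by simp only [z]; ring
    rw [this]
    refine (norm_add_le _ _).trans_lt ?_
    simp
    norm_num
  have hzre : 1 < z.re := by simp [z]; norm_num
  have heq : Set.EqOn H (P + T) U := by
    refine AnalyticOnNhd.eqOn_of_preconnected_of_eventuallyEq (hdH.analyticOnNhd hUo)
      ((hdP.add hdT).analyticOnNhd hUo) hUc hzU ?_
    filter_upwards [hUo.mem_nhds hzU,
      (isOpen_lt continuous_const Complex.continuous_re).mem_nhds hzre] with s hs hs1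
    obtain ⟨b1, b2, b3⟩ := hball s (hUball s hs)
    rw [hser s hs1, lerch_sum x hx s hs1 b2 b3]
    rfl
  have hder : deriv H 0 = deriv P 0 + deriv T 0 := by
    rw [(heq.eventuallyEq_of_mem (hUo.mem_nhds h0U)).deriv_eq]
    exact deriv_add (hdP.differentiableAt (hUo.mem_nhds h0U))
      (hdT.differentiableAt (hUo.mem_nhds h0U))
  have hP0 : deriv P 0 = ((-Real.log x / 2 + (x * Real.log x - x) : ℝ) : ℂ) := by
    refine (((lerch_half x hx).div_const 2).add (lerch_pole x hx)).deriv.trans ?_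
    push_cast; ring
  have hT0 : deriv T 0 = ((Real.log (Real.Gamma x / Real.sqrt (2 * Real.pi))
      - (-Real.log x / 2 + (x * Real.log x - x)) : ℝ) : ℂ) := by
    have t1 := (tendsto_add_atTop_iff_nat 1).2 hderT.tendsto_sum_nat
    have t2 := (Complex.continuous_ofReal.tendsto _).comp
      ((lerch_limit x hx).sub_const (-Real.log x / 2 + (x * Real.log x - x)))
    refine tendsto_nhds_unique t1 (t2.congr fun N => ?_)
    simp only [Function.comp]
    rw [← lerch_partial', Complex.ofReal_sum]
    refine Finset.sum_congr rfl fun n _ => ?_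
    rw [lerchG_deriv (x + n) (by positivity)]
  rw [hder, hP0, hT0, ← Complex.ofReal_add]
  congr 1
  ring
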